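/- Let m ≥ 3 be odd, let G(m) = ⟨x, y ∣ x² = yᵐ⟩ with Garside element Δ = x², and let φ be the automorphism with φ(x) = x⁻¹, φ(y) = y⁻¹. For every v ∈ G(m), every integer b, and all ε₁, ε₂ ∈ {1, −1}: x^{ε₁} v y^{b} Δ^{ε₂} ∼_φ x^{−ε₁} v y^{b}. (Rule (R4) is invariant under ∼_φ.) -/

import Mathlib

/-- The single relation `x² = yᵐ` of the torus knot group, over generators
indexed by `Bool` (`true ↦ x`, `false ↦ y`). -/
def torusRels (m : ℕ) : Set (FreeGroup Bool) :=
  {FreeGroup.of true ^ 2 * (FreeGroup.of false ^ m)⁻¹}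

/-- The torus knot group `⟨x, y ∣ x² = yᵐ⟩`. -/
abbrev TorusGrp (m : ℕ) : Type := PresentedGroup (torusRels m)

/-- The generator `x` of `⟨x, y ∣ x² = yᵐ⟩`. -/
def xg (m : ℕ) : TorusGrp m := PresentedGroup.of true

/-- The generator `y` of `⟨x, y ∣ x² = yᵐ⟩`. -/
def yg (m : ℕ) : TorusGrp m := PresentedGroup.of false

/-- The Garside element `Δ = x²` of `⟨x, y ∣ x² = yᵐ⟩`. -/
def Δg (m : ℕ) : TorusGrp m := xg m ^ 2

/-- `u` is `φ`-twisted conjugate to `v`: there is `w` with `v = φ(w)⁻¹ u w`. -/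
def twistedConj {G : Type*} [Group G] (φ : MulAut G) (u v : G) : Prop :=
  ∃ w : G, v = (φ w)⁻¹ * u * w

/-- The defining relation of `⟨x, y ∣ x² = yᵐ⟩`, written with the Garside element. -/
theorem Δg_eq_yg_pow (m : ℕ) : Δg m = yg m ^ m :=
  mul_inv_eq_one.mp (PresentedGroup.one_of_mem (rels := torusRels m) rfl)

/-- The Garside element is central. -/
theorem commute_Δg (m : ℕ) (g : TorusGrp m) : Commute (Δg m) g := by
  induction g using PresentedGroup.induction_on with
  | _ z =>
    induction z using FreeGroup.induction_on with
    | C1 => exact Commute.one_right _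
    | of a =>
      cases a
      · rw [Δg_eq_yg_pow]
        exact Commute.pow_self (yg m) m
      · exact Commute.pow_self (xg m) 2
    | inv_of a h =>
      rw [map_inv]
      exact h.inv_right
    | mul a b ha hb =>
      rw [map_mul]
      exact ha.mul_right hb

/-- Rule (R4) is invariant under `∼_φ`: `x^{ε₁} v y^{b} Δ^{ε₂} ∼_φ x^{−ε₁} v y^{b}`. -/
theorem twistedConj_R4 (m : ℕ) (hm : 3 ≤ m) (hodd : Odd m)
    (φ : MulAut (TorusGrp m)) (hφx : φ (xg m) = (xg m)⁻¹) (hφy : φ (yg m) = (yg m)⁻¹)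
    (v : TorusGrp m) (b : ℤ) (ε₁ ε₂ : ℤ) (hε₁ : ε₁ = 1 ∨ ε₁ = -1) (hε₂ : ε₂ = 1 ∨ ε₂ = -1) :
    twistedConj φ (xg m ^ ε₁ * v * yg m ^ b * Δg m ^ ε₂) (xg m ^ (-ε₁) * v * yg m ^ b) := by
  have hc (n : ℤ) (g : TorusGrp m) : g * Δg m ^ n = Δg m ^ n * g :=
    ((commute_Δg m g).zpow_left n).eq.symm
  have hΔ (n : ℤ) : Δg m ^ n = xg m ^ (2 * n) := by
    rw [zpow_mul]
    rfl
  have hφΔ (n : ℤ) : φ (Δg m ^ n) = (Δg m ^ n)⁻¹ := by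
    rw [hΔ, map_zpow, hφx, inv_zpow]
  by_cases h : ε₂ = ε₁
  · subst h
    refine ⟨Δg m ^ (-ε₂), ?_⟩
    rw [hφΔ, inv_inv, hc, hc, hΔ, hΔ]
    simp only [← mul_assoc, ← zpow_add]
    congr 3
    ring
  · obtain rfl : ε₂ = -ε₁ := by omega
    refine ⟨1, ?_⟩
    rw [map_one, inv_one, one_mul, mul_one, hc, hΔ]
    simp only [← mul_assoc, ← zpow_add]
    congr 3
    ring
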